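/- Let ψ : ℝ₊ → ℝ₊ be non-increasing. The set of elements x ∈ L for which the inequality ‖qx − p‖ < ψ(‖q‖) has infinitely many solutions q, p ∈ 𝔽[X] with q ≠ 0 is null or full with respect to the Haar measure on L (i.e. its intersection with the unit ball has measure 0 or full measure) according as the series Σ_{r=1}^{∞} ψ(r) converges or diverges. -/

import Mathlib

open MeasureTheory Filter Asymptotics
open scoped Classical

/-- The absolute value on `L`, the field of formal Laurent series in `X⁻¹` over
the finite field `F` with `k = Fintype.card F` elements (here realised as
`LaurentSeries F` in the variable `t = X⁻¹`): `‖x‖ = k ^ (-order x)`, `‖0‖ = 0`. -/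
noncomputable def lnorm (F : Type*) [Field F] [Fintype F] (x : LaurentSeries F) : ℝ :=
  if x = 0 then 0 else (Fintype.card F : ℝ) ^ (-x.order)

/-- The embedding of the polynomial ring `F[X]` into `L`, sending `X` to the
Laurent series with a single term of order `-1` (the element of norm `k`). -/
noncomputable def polyToL (F : Type*) [Field F] [Fintype F] (p : Polynomial F) :
    LaurentSeries F :=
  Polynomial.aeval (HahnSeries.single (-1 : ℤ) (1 : F)) p

/-- Sup norm `‖·‖_∞` of a vector over `L`. -/
noncomputable def vnorm (F : Type*) [Field F] [Fintype F] {ι : Type*}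
    (v : ι → LaurentSeries F) : ℝ :=
  ⨆ i, lnorm F (v i)

/-- Sup norm `‖·‖_∞` of a vector of polynomials, viewed inside `L`. -/
noncomputable def pvnorm (F : Type*) [Field F] [Fintype F] {ι : Type*}
    (q : ι → Polynomial F) : ℝ :=
  vnorm F fun i => polyToL F (q i)

/-- The row vector `q A ∈ L^n`, for `q ∈ F[X]^m` and an `m × n` matrix `A` over `L`. -/
noncomputable def rowMul (F : Type*) [Field F] [Fintype F] {m n : ℕ}
    (q : Fin m → Polynomial F) (A : Fin m → Fin n → LaurentSeries F) :
    Fin n → LaurentSeries F :=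
  fun j => ∑ i, polyToL F (q i) * A i j

noncomputable instance (F : Type*) [Field F] [Fintype F] :
    MeasurableSpace (LaurentSeries F) := borel _

section LaurentBalls

variable {F : Type*} [Field F]

/-- The series all of whose coefficients of index at most `n` vanish, i.e. the open ball of
radius `k ^ (-n)` about the origin. -/
def tailBall (F : Type*) [Field F] (n : ℤ) : AddSubgroup (LaurentSeries F) where
  carrier := {x | ∀ j ≤ n, x.coeff j = 0}
  zero_mem' := by simp
  add_mem' := by
    intro x y hx hy j hj
    simp [hx j hj, hy j hj]
  neg_mem' := by
    intro x hx j hj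
    simp [hx j hj]

lemma mem_tailBall {n : ℤ} {x : LaurentSeries F} :
    x ∈ tailBall F n ↔ ∀ j ≤ n, x.coeff j = 0 := Iff.rfl

lemma mem_tailBall_iff_lt_orderTop {n : ℤ} {x : LaurentSeries F} :
    x ∈ tailBall F n ↔ (n : WithTop ℤ) < x.orderTop := by
  constructor
  · intro h
    by_contra hlt
    rw [not_lt] at hlt
    have hx : x ≠ 0 := by
      rintro rfl
      simp at hlt
    rw [← HahnSeries.order_eq_orderTop_of_ne_zero hx, WithTop.coe_le_coe] at hlt
    exact HahnSeries.coeff_order_eq_zero.not.mpr hx (h _ hlt)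
  · intro h j hj
    exact HahnSeries.coeff_eq_zero_of_lt_orderTop
      (lt_of_le_of_lt (WithTop.coe_le_coe.mpr hj) h)

lemma tailBall_anti {m n : ℤ} (h : m ≤ n) : tailBall F n ≤ tailBall F m :=
  fun _ hx j hj => hx j (hj.trans h)

lemma one_lt_card [Fintype F] : (1 : ℝ) < Fintype.card F := by
  exact_mod_cast Fintype.one_lt_card

lemma lnorm_lt_zpow_iff [Fintype F] {n : ℤ} {x : LaurentSeries F} :
    lnorm F x < (Fintype.card F : ℝ) ^ (-n) ↔ x ∈ tailBall F n := by
  rw [mem_tailBall_iff_lt_orderTop]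
  have hk := one_lt_card (F := F)
  by_cases hx : x = 0
  · simp only [lnorm, hx, if_true, HahnSeries.orderTop_zero, WithTop.coe_lt_top, iff_true]
    exact zpow_pos (by linarith) _
  · rw [lnorm, if_neg hx, zpow_lt_zpow_iff_right₀ hk,
      ← HahnSeries.order_eq_orderTop_of_ne_zero hx, WithTop.coe_lt_coe]
    exact neg_lt_neg_iff

lemma single_mem_tailBall {n j : ℤ} (h : n < j) (a : F) :
    HahnSeries.single j a ∈ tailBall F n := by
  intro i hi
  exact HahnSeries.coeff_single_of_ne (by omega)

lemma mul_mem_tailBall {d n : ℤ} {x y : LaurentSeries F}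
    (hx : x ∈ tailBall F (d - 1)) (hy : y ∈ tailBall F n) : x * y ∈ tailBall F (d + n) := by
  rw [mem_tailBall_iff_lt_orderTop] at *
  rw [HahnSeries.orderTop_mul]
  induction hX : x.orderTop using WithTop.recTopCoe with
  | top => simp
  | coe a =>
  induction hY : y.orderTop using WithTop.recTopCoe with
  | top => simp
  | coe b =>
  rw [hX] at hx
  rw [hY] at hy
  have h1 : d - 1 < a := WithTop.coe_lt_coe.mp hx
  have h2 : n < b := WithTop.coe_lt_coe.mp hy
  exact WithTop.coe_lt_coe.mpr (show d + n < a + b by omega)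

lemma isOpen_tailBall (n : ℤ) : IsOpen (tailBall F n : Set (LaurentSeries F)) := by
  have hv : Valued.v (HahnSeries.single (n + 1) (1 : F) : LaurentSeries F) =
      WithZero.exp (-(n + 1)) := LaurentSeries.valuation_single_zpow F (n + 1)
  have h : (tailBall F n : Set (LaurentSeries F)) =
      {x | Valued.v.restrict x ≤
        Valued.v.restrict (HahnSeries.single (n + 1) (1 : F) : LaurentSeries F)} := by
    ext x
    rw [SetLike.mem_coe, mem_tailBall, Set.mem_ofPred_eq, Valuation.restrict_le_iff, hv,
      LaurentSeries.valuation_le_iff_coeff_lt_eq_zero]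
    simp only [Int.lt_add_one_iff]
  rw [h]
  exact Valued.isOpen_closedBall (LaurentSeries F) (by simp)

end LaurentBalls

section PolynomialPart

variable {F : Type*} [Field F] [Fintype F]

lemma polyToL_add (p q : Polynomial F) : polyToL F (p + q) = polyToL F p + polyToL F q :=
  map_add _ _ _

lemma polyToL_mul (p q : Polynomial F) : polyToL F (p * q) = polyToL F p * polyToL F q :=
  map_mul _ _ _

lemma polyToL_sub (p q : Polynomial F) : polyToL F (p - q) = polyToL F p - polyToL F q :=
  map_sub _ _ _

lemma polyToL_smul (c : F) (p : Polynomial F) : polyToL F (c • p) = HahnSeries.C c * polyToL F p := by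
  rw [Polynomial.smul_eq_C_mul, polyToL_mul, polyToL, Polynomial.aeval_C,
    LaurentSeries.algebraMap_apply]

lemma coeff_polyToL (p : Polynomial F) (j : ℤ) :
    (polyToL F p).coeff j = if j ≤ 0 then p.coeff j.natAbs else 0 := by
  induction p using Polynomial.induction_on' with
  | add p q hp hq =>
    rw [polyToL_add, HahnSeries.coeff_add, hp, hq, Polynomial.coeff_add]
    split_ifs <;> simp
  | monomial n a =>
    have : polyToL F (Polynomial.monomial n a) = HahnSeries.single (-(n : ℤ)) a := by
      rw [polyToL, Polynomial.aeval_monomial, HahnSeries.single_pow,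
        LaurentSeries.algebraMap_apply, HahnSeries.C_apply, HahnSeries.single_mul_single]
      simp
    rw [this, HahnSeries.coeff_single, Polynomial.coeff_monomial]
    split_ifs <;> first | rfl | omega

lemma polyToL_mem_tailBall {q : Polynomial F} {d : ℕ} (h : q.natDegree ≤ d) :
    polyToL F q ∈ tailBall F (-(d : ℤ) - 1) := by
  intro j hj
  rw [coeff_polyToL, if_pos (by omega)]
  exact Polynomial.coeff_eq_zero_of_natDegree_lt (by omega)

lemma polyToL_eq_zero_of_mem_tailBall {q : Polynomial F} (h : polyToL F q ∈ tailBall F 0) :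
    q = 0 := by
  ext i
  have := h (-(i : ℤ)) (by omega)
  rw [coeff_polyToL, if_pos (by omega)] at this
  simpa using this

lemma coeff_natDegree_polyToL_ne_zero {q : Polynomial F} (h : q ≠ 0) :
    (polyToL F q).coeff (-(q.natDegree : ℤ)) ≠ 0 := by
  rw [coeff_polyToL, if_pos (by omega)]
  simpa using h

lemma orderTop_polyToL {q : Polynomial F} (h : q ≠ 0) :
    (polyToL F q).orderTop = ((-(q.natDegree : ℤ) : ℤ) : WithTop ℤ) := by
  apply le_antisymm
  · exact HahnSeries.orderTop_le_of_coeff_ne_zero (coeff_natDegree_polyToL_ne_zero h)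
  · have := mem_tailBall_iff_lt_orderTop.mp (polyToL_mem_tailBall (le_refl q.natDegree))
    rcases hX : (polyToL F q).orderTop with _ | a
    · exact le_top
    · rw [hX] at this
      have h1 : -(q.natDegree : ℤ) - 1 < a := WithTop.coe_lt_coe.mp this
      exact WithTop.coe_le_coe.mpr (by omega)

lemma lnorm_polyToL {q : Polynomial F} (h : q ≠ 0) :
    lnorm F (polyToL F q) = (Fintype.card F : ℝ) ^ q.natDegree := by
  have h0 : polyToL F q ≠ 0 := by
    intro h0
    apply coeff_natDegree_polyToL_ne_zero h
    rw [h0, HahnSeries.coeff_zero]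
  have h1 := orderTop_polyToL h
  rw [← HahnSeries.order_eq_orderTop_of_ne_zero h0, WithTop.coe_inj] at h1
  rw [lnorm, if_neg h0, h1]
  simp

/-- Multiplication by a nonzero polynomial shifts balls exactly by its degree. -/
lemma polyToL_mul_mem_tailBall_iff {q : Polynomial F} (h : q ≠ 0) {n : ℤ}
    {x : LaurentSeries F} :
    polyToL F q * x ∈ tailBall F n ↔ x ∈ tailBall F (n + q.natDegree) := by
  rw [mem_tailBall_iff_lt_orderTop, mem_tailBall_iff_lt_orderTop, HahnSeries.orderTop_mul,
    orderTop_polyToL h]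
  induction hX : x.orderTop using WithTop.recTopCoe with
  | top => simp
  | coe a =>
  · change ((n : ℤ) : WithTop ℤ) < ((-(q.natDegree : ℤ) + a : ℤ) : WithTop ℤ) ↔
      ((n + q.natDegree : ℤ) : WithTop ℤ) < ((a : ℤ) : WithTop ℤ)
    rw [WithTop.coe_lt_coe, WithTop.coe_lt_coe]
    omega

lemma exists_sub_polyToL_mem_tailBall (x : LaurentSeries F) :
    ∃ p : Polynomial F, x - polyToL F p ∈ tailBall F 0 := by
  set N : ℕ := x.order.natAbs + 1 with hN
  refine ⟨∑ i ∈ Finset.range N, Polynomial.monomial i (x.coeff (-(i : ℤ))), ?_⟩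
  intro j hj
  rw [HahnSeries.coeff_sub, coeff_polyToL, if_pos hj, Polynomial.finsetSum_coeff]
  simp only [Polynomial.coeff_monomial, Finset.sum_ite_eq', Finset.mem_range]
  have h1 : -((j.natAbs : ℕ) : ℤ) = j := by omega
  rw [h1]
  split_ifs with h
  · simp
  · rw [sub_zero]
    exact HahnSeries.coeff_eq_zero_of_lt_order (by omega)

/-- Dirichlet's approximation theorem. -/
lemma exists_approx (x : LaurentSeries F) (n : ℕ) :
    ∃ q p : Polynomial F, q ≠ 0 ∧ q.natDegree ≤ n ∧
      polyToL F q * x - polyToL F p ∈ tailBall F n := by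
  let f : Polynomial.degreeLT F (n + 1) →ₗ[F] (Fin n → F) :=
    { toFun := fun q i => (polyToL F q.1 * x).coeff ((i : ℤ) + 1)
      map_add' := by
        intro q r
        ext i
        simp [polyToL_add, add_mul]
      map_smul' := by
        intro c q
        ext i
        change (polyToL F (c • q.1) * x).coeff _ = c * (polyToL F q.1 * x).coeff _
        rw [polyToL_smul, mul_assoc, HahnSeries.C_mul_eq_smul, HahnSeries.coeff_smul,
          smul_eq_mul] }
  have hfin : Module.finrank F (Polynomial.degreeLT F (n + 1)) = n + 1 := by
    rw [(Polynomial.degreeLTEquiv F (n + 1)).finrank_eq]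
    simp
  have : FiniteDimensional F (Polynomial.degreeLT F (n + 1)) :=
    Module.Finite.equiv (Polynomial.degreeLTEquiv F (n + 1)).symm
  have hker : LinearMap.ker f ≠ ⊥ := LinearMap.ker_ne_bot_of_finrank_lt (by simp [hfin])
  obtain ⟨q, hq, hq0⟩ := (Submodule.ne_bot_iff _).mp hker
  obtain ⟨p, hp⟩ := exists_sub_polyToL_mem_tailBall (polyToL F q.1 * x)
  have hq1 : (q : Polynomial F) ≠ 0 := by simpa using hq0
  refine ⟨q.1, p, hq1, ?_, ?_⟩
  · have := Polynomial.mem_degreeLT.mp q.2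
    have := (Polynomial.natDegree_lt_iff_degree_lt hq1).mpr this
    omega
  · intro j hj
    rcases le_or_gt j 0 with h | h
    · exact hp j h
    · have h2 := congrFun (LinearMap.mem_ker.mp hq) ⟨j.toNat - 1, by omega⟩
      have h3 : (((j.toNat - 1 : ℕ) : ℤ) + 1) = j := by omega
      have h4 : (polyToL F q.1 * x).coeff j = 0 := by
        rw [← h3]
        exact h2
      rw [HahnSeries.coeff_sub, h4, coeff_polyToL, if_neg (by omega), sub_zero]

end PolynomialPart

section Invariant

variable {F : Type*} [Field F]

/-- `W` is a union of balls of radius `k ^ (-r)`. -/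
def BallInvariant (r : ℕ) (W : Set (LaurentSeries F)) : Prop :=
  ∀ x ∈ W, ∀ y ∈ tailBall F r, x + y ∈ W

namespace BallInvariant

variable {r s : ℕ} {V W : Set (LaurentSeries F)}

lemma mono (hW : BallInvariant r W) (h : r ≤ s) : BallInvariant s W :=
  fun x hx y hy => hW x hx y (tailBall_anti (by exact_mod_cast h) hy)

lemma inter (hV : BallInvariant r V) (hW : BallInvariant r W) : BallInvariant r (V ∩ W) :=
  fun x hx y hy => ⟨hV x hx.1 y hy, hW x hx.2 y hy⟩

lemma diff (hV : BallInvariant r V) (hW : BallInvariant r W) : BallInvariant r (V \ W) := by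
  refine fun x hx y hy => ⟨hV x hx.1 y hy, fun h => hx.2 ?_⟩
  simpa using hW _ h (-y) (neg_mem hy)

lemma biUnion {ι : Type*} {I : Set ι} {A : ι → Set (LaurentSeries F)}
    (h : ∀ i ∈ I, BallInvariant r (A i)) : BallInvariant r (⋃ i ∈ I, A i) := by
  intro x hx y hy
  simp only [Set.mem_iUnion] at hx ⊢
  obtain ⟨i, hi, hx⟩ := hx
  exact ⟨i, hi, h i hi x hx y hy⟩

lemma isOpen (hW : BallInvariant r W) : IsOpen W := by
  rw [isOpen_iff_mem_nhds]
  intro x hx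
  have hopen : IsOpen ((fun z => z - x) ⁻¹' (tailBall F r : Set (LaurentSeries F))) :=
    (isOpen_tailBall r).preimage (continuous_sub_right x)
  refine Filter.mem_of_superset (hopen.mem_nhds (by simp)) ?_
  intro z hz
  simpa using hW x hx (z - x) hz

end BallInvariant

lemma ballInvariant_tailBall {n r : ℕ} (h : n ≤ r) :
    BallInvariant r (tailBall F n : Set (LaurentSeries F)) :=
  fun _ hx _ hy => add_mem hx (tailBall_anti (by exact_mod_cast h) hy)

end Invariant

section ApproxSet

variable {F : Type*} [Field F] [Fintype F]

/-- The series `x` with `‖q x - p‖ < k ^ (-n)` for some reduced fraction `p / q` whose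
denominator has degree `e`. -/
def approxSet (F : Type*) [Field F] [Fintype F] (e n : ℕ) : Set (LaurentSeries F) :=
  {x | ∃ q p : Polynomial F, q ≠ 0 ∧ IsCoprime q p ∧ q.natDegree = e ∧
    polyToL F q * x - polyToL F p ∈ tailBall F n}

lemma approxSet_anti {e m n : ℕ} (h : m ≤ n) : approxSet F e n ⊆ approxSet F e m := by
  rintro x ⟨q, p, hq, hc, he, hx⟩
  exact ⟨q, p, hq, hc, he, tailBall_anti (by exact_mod_cast h) hx⟩

lemma ballInvariant_approxSet (e n : ℕ) : BallInvariant (n + e) (approxSet F e n) := by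
  rintro x ⟨q, p, hq, hc, he, hx⟩ y hy
  refine ⟨q, p, hq, hc, he, ?_⟩
  have h : polyToL F q * y ∈ tailBall F n := by
    rw [polyToL_mul_mem_tailBall_iff hq, he]
    exact_mod_cast hy
  have := add_mem hx h
  convert this using 1
  ring

/-- Two good approximations to the same series are the same fraction. -/
lemma mul_eq_mul_of_approx {n : ℕ} {x : LaurentSeries F} {q p q' p' : Polynomial F}
    (hd : q.natDegree ≤ n) (hd' : q'.natDegree ≤ n)
    (h : polyToL F q * x - polyToL F p ∈ tailBall F n)
    (h' : polyToL F q' * x - polyToL F p' ∈ tailBall F n) : q * p' = q' * p := by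
  rw [← sub_eq_zero]
  apply polyToL_eq_zero_of_mem_tailBall
  have h1 := mul_mem_tailBall (polyToL_mem_tailBall (F := F) hd') h
  have h2 := mul_mem_tailBall (polyToL_mem_tailBall (F := F) hd) h'
  have h3 := sub_mem h1 h2
  rw [neg_add_cancel] at h3
  convert h3 using 1
  rw [polyToL_sub, polyToL_mul, polyToL_mul]
  ring

lemma exists_unit_of_approx {n : ℕ} {x : LaurentSeries F} {q p q' p' : Polynomial F}
    (hq : q ≠ 0) (hc : IsCoprime q p) (hc' : IsCoprime q' p')
    (hd : q.natDegree ≤ n) (hd' : q'.natDegree ≤ n)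
    (h : polyToL F q * x - polyToL F p ∈ tailBall F n)
    (h' : polyToL F q' * x - polyToL F p' ∈ tailBall F n) :
    ∃ u : (Polynomial F)ˣ, q' = q * u ∧ p' = p * u := by
  have hE := mul_eq_mul_of_approx hd hd' h h'
  have h1 : q ∣ q' := hc.dvd_of_dvd_mul_right ⟨p', hE.symm⟩
  have h2 : q' ∣ q := hc'.dvd_of_dvd_mul_right ⟨p, hE⟩
  obtain ⟨u, hu⟩ := associated_of_dvd_dvd h1 h2
  refine ⟨u, hu.symm, ?_⟩
  rw [← hu, mul_assoc] at hE
  rw [mul_left_cancel₀ hq hE, mul_comm]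

lemma disjoint_approxSet {d e n : ℕ} (hde : d ≠ e) (hd : d ≤ n) (he : e ≤ n) :
    Disjoint (approxSet F d n) (approxSet F e n) := by
  rw [Set.disjoint_left]
  rintro x ⟨q, p, hq, hc, rfl, hx⟩ ⟨q', p', hq', hc', rfl, hx'⟩
  obtain ⟨u, hu, -⟩ := exists_unit_of_approx hq hc hc' hd he hx hx'
  apply hde
  rw [hu, Polynomial.natDegree_mul hq u.ne_zero, Polynomial.natDegree_eq_zero_of_isUnit u.isUnit,
    add_zero]

lemma exists_mem_approxSet {n : ℕ} {x : LaurentSeries F} {q p : Polynomial F} (hq : q ≠ 0)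
    (h : polyToL F q * x - polyToL F p ∈ tailBall F n) :
    ∃ e ≤ q.natDegree, x ∈ approxSet F e (n + (q.natDegree - e)) := by
  obtain ⟨q', hq'⟩ := EuclideanDomain.gcd_dvd_left q p
  obtain ⟨p', hp'⟩ := EuclideanDomain.gcd_dvd_right q p
  set g := EuclideanDomain.gcd q p with hg
  have hg0 : g ≠ 0 := by
    rintro h0
    rw [h0, zero_mul] at hq'
    exact hq hq'
  have hq0 : q' ≠ 0 := by
    rintro rfl
    rw [mul_zero] at hq'
    exact hq hq'
  have hdeg : q.natDegree = g.natDegree + q'.natDegree := by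
    conv_lhs => rw [hq', Polynomial.natDegree_mul hg0 hq0]
  refine ⟨q'.natDegree, by omega, q', p', hq0, ?_, rfl, ?_⟩
  · have hb := EuclideanDomain.gcd_eq_gcd_ab q p
    refine ⟨EuclideanDomain.gcdA q p, EuclideanDomain.gcdB q p, ?_⟩
    apply mul_left_cancel₀ hg0
    rw [mul_one]
    rw [← hg] at hb
    calc _ = (g * q') * EuclideanDomain.gcdA q p + (g * p') * EuclideanDomain.gcdB q p := by ring
      _ = g := by rw [← hq', ← hp', ← hb]
  · have h1 : polyToL F q * x - polyToL F p =
        polyToL F g * (polyToL F q' * x - polyToL F p') := by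
      rw [mul_sub, ← mul_assoc, ← polyToL_mul, ← polyToL_mul, ← hq', ← hp']
    rw [h1, polyToL_mul_mem_tailBall_iff hg0] at h
    have h2 : ((n + (q.natDegree - q'.natDegree) : ℕ) : ℤ) = n + g.natDegree := by omega
    rw [h2]
    exact h

lemma iUnion_approxSet (n : ℕ) :
    ⋃ e ∈ Finset.range (n + 1), approxSet F e n = Set.univ := by
  rw [Set.eq_univ_iff_forall]
  intro x
  obtain ⟨q, p, hq, hd, hx⟩ := exists_approx x n
  obtain ⟨e, he, hxe⟩ := exists_mem_approxSet hq hx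
  simp only [Set.mem_iUnion, Finset.mem_range]
  exact ⟨e, by omega, approxSet_anti (by omega) hxe⟩

/-- Translating by the `k` multiples of a monomial splits one approximation set into translates
of the next. -/
lemma approxSet_eq_iUnion (e n : ℕ) :
    approxSet F e n = ⋃ a : F,
      (fun x => x + HahnSeries.single ((n + e : ℕ) + 1 : ℤ) a) ⁻¹' approxSet F e (n + 1) := by
  ext x
  simp only [Set.mem_iUnion, Set.mem_preimage]
  constructor
  · rintro ⟨q, p, hq, hc, he, hx⟩
    set c := (polyToL F q * x - polyToL F p).coeff (n + 1) with hcdef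
    set b := (polyToL F q).coeff (-(q.natDegree : ℤ)) with hb
    have hb0 : b ≠ 0 := coeff_natDegree_polyToL_ne_zero hq
    refine ⟨-(c / b), q, p, hq, hc, he, ?_⟩
    intro j hj
    have h1 : polyToL F q * (x + HahnSeries.single ((n + e : ℕ) + 1 : ℤ) (-(c / b))) -
        polyToL F p = (polyToL F q * x - polyToL F p) +
          polyToL F q * HahnSeries.single ((n + e : ℕ) + 1 : ℤ) (-(c / b)) := by ring
    rw [h1, HahnSeries.coeff_add]
    have h2 : (polyToL F q * HahnSeries.single ((n + e : ℕ) + 1 : ℤ) (-(c / b))).coeff j =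
        (polyToL F q).coeff (j - ((n + e : ℕ) + 1)) * -(c / b) := by
      have := HahnSeries.coeff_mul_single_add (x := polyToL F q)
        (a := j - ((n + e : ℕ) + 1)) (b := ((n + e : ℕ) + 1 : ℤ)) (r := -(c / b))
      rwa [sub_add_cancel] at this
    rw [h2]
    rcases (show j ≤ n ∨ j = n + 1 by push_cast at hj; omega) with hj' | rfl
    · rw [hx j hj', coeff_polyToL, if_pos (by push_cast; omega),
        Polynomial.coeff_eq_zero_of_natDegree_lt (by push_cast; omega)]
      simp
    · have h3 : (n + 1 - ((n + e : ℕ) + 1) : ℤ) = -(q.natDegree : ℤ) := by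
        push_cast
        omega
      rw [h3, ← hb, ← hcdef]
      field_simp
      ring
  · rintro ⟨a, ha⟩
    have := ballInvariant_approxSet e n _ (approxSet_anti n.le_succ ha) _
      (neg_mem (single_mem_tailBall (lt_add_one ((n + e : ℕ) : ℤ)) a))
    simpa using this

lemma pairwise_disjoint_approxSet_translates {e n : ℕ} (h : e ≤ n) :
    Pairwise (Function.onFun Disjoint fun a : F =>
      (fun x => x + HahnSeries.single ((n + e : ℕ) + 1 : ℤ) a) ⁻¹' approxSet F e (n + 1)) := by
  intro a a' haa
  rw [Function.onFun, Set.disjoint_left]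
  rintro x ⟨q, p, hq, hc, he, hx⟩ ⟨q', p', hq', hc', he', hx'⟩
  set y := HahnSeries.single ((n + e : ℕ) + 1 : ℤ) a with hy
  set y' := HahnSeries.single ((n + e : ℕ) + 1 : ℤ) a' with hy'
  have key : ∀ q p : Polynomial F, ∀ z ∈ tailBall F ((n + e : ℕ) : ℤ), q ≠ 0 →
      q.natDegree = e → polyToL F q * (x + z) - polyToL F p ∈ tailBall F ((n + 1 : ℕ) : ℤ) →
      polyToL F q * x - polyToL F p ∈ tailBall F n := by
    intro q p z hz hq he hx
    have h1 : polyToL F q * z ∈ tailBall F n := by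
      rw [polyToL_mul_mem_tailBall_iff hq, he]
      exact_mod_cast hz
    have h2 := sub_mem (tailBall_anti (show (n : ℤ) ≤ (n + 1 : ℕ) by omega) hx) h1
    convert h2 using 1
    ring
  have h1 := key q p y (single_mem_tailBall (by omega) a) hq he hx
  have h2 := key q' p' y' (single_mem_tailBall (by omega) a') hq' he' hx'
  obtain ⟨u, rfl, rfl⟩ := exists_unit_of_approx hq hc hc' (by omega) (by omega) h1 h2
  have hu : (u : Polynomial F).natDegree = 0 :=
    Polynomial.natDegree_eq_zero_of_isUnit u.isUnit
  have h3 : polyToL F q * (x + y') - polyToL F p ∈ tailBall F ((n + 1 : ℕ) : ℤ) := by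
    have h4 : polyToL F (q * u) * (x + y') - polyToL F (p * u) =
        polyToL F u * (polyToL F q * (x + y') - polyToL F p) := by
      rw [polyToL_mul, polyToL_mul]
      ring
    simp only at hx'
    rw [h4, polyToL_mul_mem_tailBall_iff u.ne_zero, hu] at hx'
    simpa using hx'
  have h5 : polyToL F q * (y - y') ∈ tailBall F ((n + 1 : ℕ) : ℤ) := by
    have := sub_mem hx h3
    convert this using 1
    ring
  rw [polyToL_mul_mem_tailBall_iff hq, he] at h5
  have h6 := h5 ((n + e : ℕ) + 1 : ℤ) (by push_cast; omega)
  rw [hy, hy', HahnSeries.coeff_sub, HahnSeries.coeff_single_same, HahnSeries.coeff_single_same,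
    sub_eq_zero] at h6
  exact haa h6

end ApproxSet

section Measure

variable {F : Type*} [Field F] [Fintype F]

instance : BorelSpace (LaurentSeries F) := ⟨rfl⟩

lemma BallInvariant.measurableSet {r : ℕ} {W : Set (LaurentSeries F)} (hW : BallInvariant r W) :
    MeasurableSet W :=
  hW.isOpen.measurableSet

lemma measurableSet_approxSet (e n : ℕ) : MeasurableSet (approxSet F e n) :=
  (ballInvariant_approxSet e n).measurableSet

lemma sum_measureReal_approxSet_inter (ν : Measure (LaurentSeries F)) (n : ℕ) {W : Set (LaurentSeries F)}
    (hW : MeasurableSet W) (hfin : ν W ≠ ⊤) :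
    ∑ e ∈ Finset.range (n + 1), ν.real (approxSet F e n ∩ W) = ν.real W := by
  have hcov : W = ⋃ e ∈ Finset.range (n + 1), approxSet F e n ∩ W := by
    rw [← Set.iUnion₂_inter, iUnion_approxSet, Set.univ_inter]
  conv_rhs => rw [hcov]
  symm
  apply measureReal_biUnion_finset
  · intro d hd e he hde
    simp only [Finset.coe_range, Set.mem_Iio] at hd he
    exact (disjoint_approxSet hde (by omega) (by omega)).mono
      Set.inter_subset_left Set.inter_subset_left
  · intro e _
    exact (measurableSet_approxSet _ _).inter hW
  · intro e _
    exact measure_ne_top_of_subset Set.inter_subset_right hfin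

variable (ν : Measure (LaurentSeries F)) [ν.IsAddHaarMeasure]

lemma measure_approxSet_inter {e n : ℕ} (h : e ≤ n) {W : Set (LaurentSeries F)}
    (hW : BallInvariant (n + e) W) :
    ν (approxSet F e n ∩ W) = Fintype.card F * ν (approxSet F e (n + 1) ∩ W) := by
  have hsplit : approxSet F e n ∩ W = ⋃ a : F,
      (fun x => x + HahnSeries.single ((n + e : ℕ) + 1 : ℤ) a) ⁻¹'
        (approxSet F e (n + 1) ∩ W) := by
    rw [approxSet_eq_iUnion, Set.iUnion_inter]
    refine Set.iUnion_congr fun a => ?_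
    rw [Set.preimage_inter]
    congr 1
    have hs := single_mem_tailBall (lt_add_one ((n + e : ℕ) : ℤ)) a
    ext x
    refine ⟨fun hx => hW x hx _ hs, fun hx => ?_⟩
    simpa using hW _ hx _ (neg_mem hs)
  rw [hsplit, measure_iUnion]
  · simp only [measure_preimage_add_right, tsum_fintype, Finset.sum_const, Finset.card_univ,
      nsmul_eq_mul]
  · intro a b hab
    exact (pairwise_disjoint_approxSet_translates h hab).mono
      (Set.preimage_mono Set.inter_subset_left) (Set.preimage_mono Set.inter_subset_left)
  · intro a
    exact (measurable_add_const _)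
      ((measurableSet_approxSet _ _).inter hW.measurableSet)

lemma measureReal_approxSet_inter {e n : ℕ} (h : e ≤ n) {W : Set (LaurentSeries F)}
    (hW : BallInvariant (n + e) W) (j : ℕ) :
    ν.real (approxSet F e (n + j) ∩ W) =
      ν.real (approxSet F e n ∩ W) / (Fintype.card F : ℝ) ^ j := by
  have hk : (0 : ℝ) < Fintype.card F := zero_lt_one.trans one_lt_card
  induction j with
  | zero => simp
  | succ j ih =>
    have h1 := measure_approxSet_inter ν (h.trans (Nat.le_add_right n j))
      (hW.mono (show n + e ≤ n + j + e by omega))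
    have h2 := congrArg ENNReal.toReal h1
    rw [ENNReal.toReal_mul, ENNReal.toReal_natCast] at h2
    change ν.real _ = _ * ν.real _ at h2
    rw [← add_assoc, pow_succ, ← div_div, ← ih, h2]
    field_simp

/-- In each ball, the series with a convergent denominator of large degree `n` have
proportion `1 - 1 / k`. -/
lemma measureReal_approxSet_self_inter {r n : ℕ} (h : r ≤ n) {W : Set (LaurentSeries F)}
    (hW : BallInvariant r W) (hfin : ν W ≠ ⊤) :
    ν.real (approxSet F (n + 1) (n + 1) ∩ W) = (1 - 1 / (Fintype.card F : ℝ)) * ν.real W := by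
  have h1 := sum_measureReal_approxSet_inter ν (n + 1) hW.measurableSet hfin
  have h2 := sum_measureReal_approxSet_inter ν n hW.measurableSet hfin
  rw [Finset.sum_range_succ] at h1
  have h3 : ∑ e ∈ Finset.range (n + 1), ν.real (approxSet F e (n + 1) ∩ W) =
      ν.real W / Fintype.card F := by
    rw [← h2, Finset.sum_div]
    refine Finset.sum_congr rfl fun e he => ?_
    rw [Finset.mem_range] at he
    have := measureReal_approxSet_inter ν (show e ≤ n by omega)
      (hW.mono (show r ≤ n + e by omega)) 1
    simpa using this
  rw [h3] at h1
  linear_combination h1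

/-- The series in the unit ball lying in none of the sets `approxSet F d (f d)` for
`N ≤ d < M`. -/
def avoidSet (F : Type*) [Field F] [Fintype F] (f : ℕ → ℕ) (N M : ℕ) : Set (LaurentSeries F) :=
  (tailBall F 0 : Set (LaurentSeries F)) \ ⋃ d ∈ Set.Ico N M, approxSet F d (f d)

lemma exists_ballInvariant_avoidSet (f : ℕ → ℕ) (N M : ℕ) :
    ∃ r, BallInvariant r (avoidSet F f N M) := by
  refine ⟨∑ d ∈ Finset.range M, (f d + d), ?_⟩
  refine BallInvariant.diff (ballInvariant_tailBall (n := 0) (Nat.zero_le _))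
    (BallInvariant.biUnion fun d hd => (ballInvariant_approxSet d (f d)).mono ?_)
  exact Finset.single_le_sum (f := fun d => f d + d) (fun _ _ => Nat.zero_le _)
    (Finset.mem_range.mpr hd.2)

lemma avoidSet_anti (f : ℕ → ℕ) (N : ℕ) : Antitone (avoidSet F f N) := fun _ _ h =>
  Set.sdiff_subset_sdiff_right
    (Set.biUnion_subset_biUnion_left (Set.Ico_subset_Ico_right h))

lemma avoidSet_succ (f : ℕ → ℕ) {N M : ℕ} (h : N ≤ M) :
    avoidSet F f N (M + 1) = avoidSet F f N M \ approxSet F M (f M) := by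
  ext x
  simp only [avoidSet, Set.mem_sdiff, Set.mem_iUnion, Set.mem_Ico, not_exists]
  constructor
  · rintro ⟨hx, h1⟩
    exact ⟨⟨hx, fun d hd => h1 d ⟨hd.1, by omega⟩⟩, h1 M ⟨h, by omega⟩⟩
  · rintro ⟨⟨hx, h1⟩, h2⟩
    refine ⟨hx, fun d hd => ?_⟩
    rcases eq_or_ne d M with rfl | hne
    · exact h2
    · exact h1 d ⟨hd.1, by omega⟩

/-- The part of `avoidSet F f N M₀` removed before stage `M`, met again at stage `M`, consists of
few balls: at stage `M` only a proportion `k ^ (M - f M)` of it recurs. -/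
lemma measureReal_recurrence_le {f : ℕ → ℕ} (hf : ∀ d, d ≤ f d) {N M₀ M r : ℕ} (hM : M₀ ≤ M)
    (hN : N ≤ M₀) (hr : r ≤ M) (hG : BallInvariant r (avoidSet F f N M₀))
    (hfin : ν (tailBall F 0 : Set (LaurentSeries F)) ≠ ⊤) :
    ν.real (approxSet F M (f M) ∩ (avoidSet F f N M₀ \ avoidSet F f N M)) ≤
      (ν.real (avoidSet F f N M₀) - ν.real (avoidSet F f N M)) /
        (Fintype.card F : ℝ) ^ (f M - M) := by
  have hk : (0 : ℝ) < Fintype.card F := zero_lt_one.trans one_lt_card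
  have hfin' : ∀ A : Set (LaurentSeries F), A ⊆ avoidSet F f N M₀ → ν A ≠ ⊤ := fun A hA =>
    measure_ne_top_of_subset (hA.trans Set.sdiff_subset) hfin
  set I : Set ℕ := {d | M₀ ≤ d ∧ d < M ∧ f d < M} with hI
  set W : Set (LaurentSeries F) := avoidSet F f N M₀ ∩ ⋃ d ∈ I, approxSet F d (f d) with hW
  have hWinv : BallInvariant (M + M) W := by
    refine (hG.mono (by omega)).inter (BallInvariant.biUnion fun d hd => ?_)
    have h1 := hd.2.1
    have h2 := hd.2.2
    exact (ballInvariant_approxSet d (f d)).mono (by omega)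
  have hWsub : W ⊆ avoidSet F f N M₀ \ avoidSet F f N M := by
    rintro x ⟨hx, hxU⟩
    refine ⟨hx, fun h => h.2 ?_⟩
    simp only [Set.mem_iUnion] at hxU ⊢
    obtain ⟨d, hd, hxd⟩ := hxU
    exact ⟨d, ⟨hN.trans hd.1, hd.2.1⟩, hxd⟩
  have hsub : approxSet F M (f M) ∩ (avoidSet F f N M₀ \ avoidSet F f N M) ⊆
      approxSet F M (M + (f M - M)) ∩ W := by
    rintro x ⟨hxM, hx0, hx1⟩
    rw [Nat.add_sub_cancel' (hf M)]
    refine ⟨hxM, hx0, ?_⟩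
    have hx2 : ∃ d, (N ≤ d ∧ d < M) ∧ x ∈ approxSet F d (f d) := by
      by_contra hcon
      push Not at hcon
      refine hx1 ⟨hx0.1, ?_⟩
      simp only [Set.mem_iUnion, not_exists]
      exact fun d hd => hcon d hd
    obtain ⟨d, hd, hxd⟩ := hx2
    have hd0 : M₀ ≤ d := by
      by_contra hlt
      refine hx0.2 ?_
      simp only [Set.mem_iUnion]
      exact ⟨d, ⟨hd.1, by omega⟩, hxd⟩
    simp only [Set.mem_iUnion]
    refine ⟨d, ⟨hd0, hd.2, ?_⟩, hxd⟩
    by_contra hlt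
    exact Set.disjoint_left.mp (disjoint_approxSet hd.2.ne hd.2.le le_rfl)
      (approxSet_anti (not_lt.mp hlt) hxd) (approxSet_anti (hf M) hxM)
  calc _ ≤ ν.real (approxSet F M (M + (f M - M)) ∩ W) :=
        measureReal_mono hsub (hfin' _ (Set.inter_subset_right.trans Set.inter_subset_left))
    _ = ν.real (approxSet F M M ∩ W) / (Fintype.card F : ℝ) ^ (f M - M) :=
        measureReal_approxSet_inter ν le_rfl hWinv _
    _ ≤ _ := by
        gcongr
        calc _ ≤ ν.real (avoidSet F f N M₀ \ avoidSet F f N M) :=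
              measureReal_mono (Set.inter_subset_right.trans hWsub) (hfin' _ Set.sdiff_subset)
          _ = _ := measureReal_sdiff (avoidSet_anti f N hM)
              (exists_ballInvariant_avoidSet f N M).choose_spec.measurableSet
              (hfin' _ subset_rfl)

/-- Divergence part of the Borel–Cantelli lemma for the sets `approxSet F d (f d)`. -/
lemma measure_iInter_avoidSet {f : ℕ → ℕ} (hf : ∀ d, d ≤ f d)
    (hdiv : ¬ Summable fun d => ((Fintype.card F : ℝ) ^ (f d - d))⁻¹)
    (hfin : ν (tailBall F 0 : Set (LaurentSeries F)) ≠ ⊤) (N : ℕ) :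
    ν (⋂ M, avoidSet F f N M) = 0 := by
  have hk : (1 : ℝ) < Fintype.card F := one_lt_card
  set c : ℝ := 1 - 1 / (Fintype.card F : ℝ) with hc
  have hc0 : 0 < c := by
    rw [hc, sub_pos, div_lt_one (by linarith)]
    exact hk
  have hfin' : ∀ A : Set (LaurentSeries F), A ⊆ tailBall F 0 → ν A ≠ ⊤ := fun A hA =>
    measure_ne_top_of_subset hA hfin
  have hG0 : ∀ M, avoidSet F f N M ⊆ tailBall F 0 := fun M => Set.sdiff_subset
  have hGm : ∀ M, MeasurableSet (avoidSet F f N M) := fun M =>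
    (exists_ballInvariant_avoidSet f N M).choose_spec.measurableSet
  set g : ℝ := ν.real (⋂ M, avoidSet F f N M) with hg
  have hInt : (⋂ M, avoidSet F f N M) ⊆ tailBall F 0 := (Set.iInter_subset _ 0).trans (hG0 0)
  have hle : ∀ M, g ≤ ν.real (avoidSet F f N M) := fun M =>
    measureReal_mono (Set.iInter_subset _ M) (hfin' _ (hG0 M))
  by_contra hne
  have hgpos : 0 < g := ENNReal.toReal_pos hne (hfin' _ hInt)
  have htend : Tendsto (fun M => ν.real (avoidSet F f N M)) atTop (nhds g) :=
    (ENNReal.tendsto_toReal (hfin' _ hInt)).comp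
      (tendsto_measure_iInter_atTop (fun M => (hGm M).nullMeasurableSet)
        (avoidSet_anti f N) ⟨0, hfin' _ (hG0 0)⟩)
  obtain ⟨M₀, hM₀, hNM₀⟩ := ((htend.eventually
    (gt_mem_nhds (show g < g + c / 2 * g by nlinarith))).and (eventually_ge_atTop N)).exists
  obtain ⟨r, hr⟩ := exists_ballInvariant_avoidSet (F := F) f N M₀
  set R := M₀ + r + 1 with hR
  have hstep : ∀ M, R ≤ M → c / 2 * g * ((Fintype.card F : ℝ) ^ (f M - M))⁻¹ ≤
      ν.real (avoidSet F f N M) - ν.real (avoidSet F f N (M + 1)) := by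
    intro M hM
    have h1 : ν.real (approxSet F M (f M) ∩ avoidSet F f N M₀) =
        c * ν.real (avoidSet F f N M₀) / (Fintype.card F : ℝ) ^ (f M - M) := by
      obtain ⟨n, rfl⟩ : ∃ n, M = n + 1 := ⟨M - 1, by omega⟩
      rw [← measureReal_approxSet_self_inter ν (show r ≤ n by omega) hr (hfin' _ (hG0 _)),
        ← measureReal_approxSet_inter ν le_rfl (hr.mono (by omega)),
        Nat.add_sub_cancel' (hf _)]
    have h2 := measureReal_recurrence_le ν hf (show M₀ ≤ M by omega) hNM₀
      (show r ≤ M by omega) hr hfin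
    have h3 : ν.real (approxSet F M (f M) ∩ avoidSet F f N M₀) ≤
        ν.real (approxSet F M (f M) ∩ (avoidSet F f N M₀ \ avoidSet F f N M)) +
        ν.real (avoidSet F f N M \ avoidSet F f N (M + 1)) := by
      refine (measureReal_mono ?_ ?_).trans (measureReal_union_le _ _)
      · rintro x ⟨hx, hx0⟩
        rw [avoidSet_succ f (show N ≤ M by omega)]
        by_cases hxM : x ∈ avoidSet F f N M
        · exact Or.inr ⟨hxM, fun h => h.2 hx⟩
        · exact Or.inl ⟨hx, hx0, hxM⟩
      · refine hfin' _ (Set.union_subset ?_ (Set.sdiff_subset.trans (hG0 _)))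
        exact Set.inter_subset_right.trans (Set.sdiff_subset.trans (hG0 _))
    rw [measureReal_sdiff (avoidSet_anti f N M.le_succ) (hGm _) (hfin' _ (hG0 _))] at h3
    have h4 : ν.real (avoidSet F f N M₀) - ν.real (avoidSet F f N M) ≤ c / 2 * g := by
      linarith [hle M]
    have h5 : 0 < ((Fintype.card F : ℝ) ^ (f M - M))⁻¹ := by positivity
    rw [div_eq_mul_inv] at h1 h2
    have h6 := mul_le_mul_of_nonneg_right h4 h5.le
    have h7 := mul_le_mul_of_nonneg_right
      (mul_le_mul_of_nonneg_left (hle M₀) hc0.le) h5.le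
    linarith
  apply hdiv
  rw [← summable_nat_add_iff R]
  refine summable_of_sum_range_le
    (c := ν.real (avoidSet F f N R) / (c / 2 * g)) (fun _ => by positivity) fun n => ?_
  rw [le_div_iff₀ (by positivity), Finset.sum_mul]
  calc _ ≤ ∑ i ∈ Finset.range n, (ν.real (avoidSet F f N (i + R)) -
        ν.real (avoidSet F f N (i + 1 + R))) := by
        refine Finset.sum_le_sum fun i _ => ?_
        rw [mul_comm, show i + 1 + R = i + R + 1 by omega]
        exact hstep (i + R) (by omega)
    _ = ν.real (avoidSet F f N (0 + R)) - ν.real (avoidSet F f N (n + R)) :=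
        Finset.sum_range_sub' (fun i => ν.real (avoidSet F f N (i + R))) n
    _ ≤ _ := by
        rw [zero_add]
        linarith [measureReal_nonneg (μ := ν) (s := avoidSet F f N (n + R))]

end Measure

section Conclusion

variable {F : Type*} [Field F] [Fintype F]

lemma summable_condensed_card {ψ : ℝ → ℝ} (hψpos : ∀ x > (0 : ℝ), 0 < ψ x)
    (hψdec : AntitoneOn ψ (Set.Ioi 0)) :
    (Summable fun d : ℕ => (Fintype.card F : ℝ) ^ d * ψ ((Fintype.card F : ℝ) ^ d)) ↔
      Summable fun r : ℕ => ψ ((r : ℝ) + 1) := by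
  set k := Fintype.card F with hk
  have hk1 : 1 < k := Fintype.one_lt_card
  have hkR : (1 : ℝ) < k := by exact_mod_cast hk1
  have hpos : ∀ n : ℕ, (0 : ℝ) < ((max n 1 : ℕ) : ℝ) := fun n => by
    exact_mod_cast Nat.lt_of_lt_of_le Nat.zero_lt_one (le_max_right n 1)
  have h := summable_schlomilch_iff_of_nonneg (C := k) (u := fun d => k ^ d)
    (f := fun n : ℕ => ψ ((max n 1 : ℕ) : ℝ)) (fun n => (hψpos _ (hpos n)).le)
    (fun m n _ hmn => hψdec (hpos m) (hpos n) (by exact_mod_cast max_le_max_right 1 hmn))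
    (fun d => by positivity) (pow_right_strictMono₀ hk1) (by omega)
    (fun n => by
      rw [smul_eq_mul, Nat.mul_sub, ← pow_succ', ← pow_succ'])
  rw [← summable_nat_add_iff (f := fun n : ℕ => ψ ((max n 1 : ℕ) : ℝ)) 1] at h
  have h1 : (fun n : ℕ => ψ ((max (n + 1) 1 : ℕ) : ℝ)) = fun r : ℕ => ψ ((r : ℝ) + 1) := by
    ext n
    rw [max_eq_left (by omega)]
    push_cast
    rfl
  have h2 : (fun d : ℕ => (((k ^ (d + 1) : ℕ) : ℝ) - ((k ^ d : ℕ) : ℝ)) *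
      ψ ((max (k ^ d) 1 : ℕ) : ℝ)) =
      fun d : ℕ => ((k : ℝ) - 1) * ((k : ℝ) ^ d * ψ ((k : ℝ) ^ d)) := by
    ext d
    rw [max_eq_left (Nat.one_le_pow _ _ (by omega))]
    push_cast
    ring
  rw [h1, h2, summable_mul_left_iff (by linarith)] at h
  exact h

lemma finite_setOf_polyToL_mem_tailBall (n : ℕ) :
    {p : Polynomial F | polyToL F p ∈ tailBall F (-(n : ℤ))}.Finite := by
  have : Finite (Polynomial.degreeLT F n) :=
    Finite.of_equiv _ (Polynomial.degreeLTEquiv F n).symm.toEquiv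
  refine (Set.toFinite (Polynomial.degreeLT F n : Set (Polynomial F))).subset fun p hp => ?_
  refine Polynomial.mem_degreeLT.mpr ((Polynomial.degree_lt_iff_coeff_zero p n).mpr fun i hi => ?_)
  have := hp (-(i : ℤ)) (by omega)
  rw [coeff_polyToL, if_pos (by omega)] at this
  simpa using this

/-- Only finitely many solutions have a denominator of bounded degree. -/
lemma finite_solutions_natDegree_lt {ψ : ℝ → ℝ} (hψdec : AntitoneOn ψ (Set.Ioi 0))
    {x : LaurentSeries F} (hx : x ∈ tailBall F 0) (D : ℕ) :
    {qp : Polynomial F × Polynomial F | qp.1 ≠ 0 ∧ qp.1.natDegree < D ∧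
      lnorm F (polyToL F qp.1 * x - polyToL F qp.2) <
        ψ (lnorm F (polyToL F qp.1))}.Finite := by
  have hk : (1 : ℝ) < Fintype.card F := one_lt_card
  obtain ⟨s, hs⟩ := pow_unbounded_of_one_lt (ψ 1) hk
  refine ((finite_setOf_polyToL_mem_tailBall (F := F) (D + 1)).prod
    (finite_setOf_polyToL_mem_tailBall (F := F) (D + s))).subset ?_
  rintro ⟨q, p⟩ ⟨hq, hqD, h⟩
  simp only at hq hqD h
  have hq1 : polyToL F q ∈ tailBall F (-(D : ℤ) - 1) := polyToL_mem_tailBall hqD.le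
  refine ⟨tailBall_anti (show (-((D + 1 : ℕ) : ℤ)) ≤ -D - 1 by omega) hq1, ?_⟩
  rw [lnorm_polyToL hq] at h
  have hpow : (1 : ℝ) ≤ (Fintype.card F : ℝ) ^ q.natDegree := one_le_pow₀ hk.le
  have h1 := hψdec (Set.mem_Ioi.mpr zero_lt_one)
    (Set.mem_Ioi.mpr (zero_lt_one.trans_le hpow)) hpow
  have h2 : polyToL F q * x - polyToL F p ∈ tailBall F (-(s : ℤ)) := by
    rw [← lnorm_lt_zpow_iff, neg_neg, zpow_natCast]
    linarith
  have h3 := mul_mem_tailBall hq1 hx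
  have h4 := sub_mem (tailBall_anti (show (-((D + s : ℕ) : ℤ)) ≤ -D + 0 by omega) h3)
    (tailBall_anti (show (-((D + s : ℕ) : ℤ)) ≤ -s by omega) h2)
  rw [sub_sub_cancel] at h4
  exact h4

variable (ν : Measure (LaurentSeries F)) [ν.IsAddHaarMeasure]

lemma measureReal_approxSet_inter_tailBall_le {e n : ℕ} (h : e ≤ n)
    (hν : ν (tailBall F 0 : Set (LaurentSeries F)) = 1) :
    ν.real (approxSet F e n ∩ tailBall F 0) ≤ ((Fintype.card F : ℝ) ^ (n - e))⁻¹ := by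
  have h1 := measureReal_approxSet_inter ν (le_refl e)
    (ballInvariant_tailBall (F := F) (n := 0) (Nat.zero_le (e + e))) (n - e)
  rw [Nat.add_sub_cancel' h] at h1
  simp only [Nat.cast_zero] at h1
  rw [h1, div_eq_mul_inv]
  refine mul_le_of_le_one_left (by positivity) ?_
  have h2 : ν.real (tailBall F 0 : Set (LaurentSeries F)) = 1 := by
    rw [measureReal_def, hν, ENNReal.toReal_one]
  rw [← h2]
  exact measureReal_mono Set.inter_subset_right (by simp [hν])

lemma sum_pow_two_mul_le {k : ℝ} (hk : 2 ≤ k) (d : ℕ) :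
    ∑ e ∈ Finset.range (d + 1), k ^ (2 * e) ≤ 2 * k ^ (2 * d) := by
  induction d with
  | zero => norm_num
  | succ d ih =>
    rw [Finset.sum_range_succ, show 2 * (d + 1) = 2 * d + 2 by ring, pow_add]
    have : 0 < k ^ (2 * d) := by positivity
    have hk2 : 4 ≤ k ^ 2 := by nlinarith
    nlinarith

/-- Unlike in `approxSet`, the approximating fractions need not be reduced here. -/
lemma measure_setOf_exists_approx_le {d n : ℕ} (h : d ≤ n)
    (hν : ν (tailBall F 0 : Set (LaurentSeries F)) = 1) :
    ν {x | x ∈ tailBall F 0 ∧ ∃ q p : Polynomial F, q ≠ 0 ∧ q.natDegree = d ∧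
      polyToL F q * x - polyToL F p ∈ tailBall F n} ≤
      ENNReal.ofReal (2 * ((Fintype.card F : ℝ) ^ (n - d))⁻¹) := by
  have hk : (2 : ℝ) ≤ Fintype.card F := by
    exact_mod_cast Fintype.one_lt_card (α := F)
  have hsub : {x | x ∈ tailBall F 0 ∧ ∃ q p : Polynomial F, q ≠ 0 ∧ q.natDegree = d ∧
      polyToL F q * x - polyToL F p ∈ tailBall F n} ⊆
      ⋃ e ∈ Finset.range (d + 1), approxSet F e (n + (d - e)) ∩ tailBall F 0 := by
    rintro x ⟨hx, q, p, hq, rfl, hqp⟩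
    obtain ⟨e, he, hxe⟩ := exists_mem_approxSet hq hqp
    simp only [Set.mem_iUnion, Finset.mem_range]
    exact ⟨e, by omega, hxe, hx⟩
  have hfin : ∀ A : Set (LaurentSeries F), A ⊆ tailBall F 0 → ν A ≠ ⊤ := fun A hA =>
    measure_ne_top_of_subset hA (by simp [hν])
  rw [← ENNReal.ofReal_toReal (hfin _ fun x hx => hx.1)]
  apply ENNReal.ofReal_le_ofReal
  calc _ ≤ ν.real (⋃ e ∈ Finset.range (d + 1), approxSet F e (n + (d - e)) ∩ tailBall F 0) :=
        measureReal_mono hsub (hfin _ (Set.iUnion₂_subset fun _ _ => Set.inter_subset_right))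
    _ ≤ ∑ e ∈ Finset.range (d + 1), ν.real (approxSet F e (n + (d - e)) ∩ tailBall F 0) :=
        measureReal_biUnion_finset_le _ _
    _ ≤ ∑ e ∈ Finset.range (d + 1),
          (Fintype.card F : ℝ) ^ (2 * e) * ((Fintype.card F : ℝ) ^ (n + d))⁻¹ := by
        refine Finset.sum_le_sum fun e he => ?_
        rw [Finset.mem_range] at he
        refine (measureReal_approxSet_inter_tailBall_le ν (by omega) hν).trans_eq ?_
        rw [show n + d = (n + (d - e) - e) + 2 * e by omega, pow_add]
        field_simp
    _ ≤ 2 * (Fintype.card F : ℝ) ^ (2 * d) * ((Fintype.card F : ℝ) ^ (n + d))⁻¹ := by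
        rw [← Finset.sum_mul]
        gcongr
        exact sum_pow_two_mul_le hk d
    _ = _ := by
        rw [show n + d = (n - d) + 2 * d by omega, pow_add]
        field_simp

lemma measure_infinite_solutions_eq_zero {ψ : ℝ → ℝ} (hψpos : ∀ x > (0 : ℝ), 0 < ψ x)
    (hψdec : AntitoneOn ψ (Set.Ioi 0)) (hν : ν (tailBall F 0 : Set (LaurentSeries F)) = 1)
    (hsum : Summable fun d : ℕ => (Fintype.card F : ℝ) ^ d * ψ ((Fintype.card F : ℝ) ^ d)) :
    ν ({x | {qp : Polynomial F × Polynomial F | qp.1 ≠ 0 ∧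
      lnorm F (polyToL F qp.1 * x - polyToL F qp.2) <
        ψ (lnorm F (polyToL F qp.1))}.Infinite} ∩ tailBall F 0) = 0 := by
  have hk : (1 : ℝ) < Fintype.card F := one_lt_card
  set k : ℝ := (Fintype.card F : ℝ) with hkdef
  have hk0 : 0 < k := by linarith
  obtain ⟨D, hD⟩ := eventually_atTop.mp
    (hsum.tendsto_atTop_zero.eventually (gt_mem_nhds (show (0 : ℝ) < k⁻¹ by positivity)))
  have hex : ∀ d : ℕ, ∃ n, d ≤ n ∧
      (D ≤ d → ψ (k ^ d) ≤ (k ^ n)⁻¹ ∧ (k ^ (n - d))⁻¹ ≤ k * (k ^ d * ψ (k ^ d))) := by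
    intro d
    by_cases hdD : D ≤ d
    · have hψ := hψpos (k ^ d) (by positivity)
      have hlt : ψ (k ^ d) < (k⁻¹) ^ (d + 1) := by
        rw [inv_pow, pow_succ, mul_inv, ← div_eq_inv_mul, lt_div_iff₀ (by positivity), mul_comm]
        exact hD d hdD
      obtain ⟨n, hn1, hn2⟩ := exists_nat_pow_near_of_lt_one hψ
        (hlt.le.trans (pow_le_one₀ (by positivity) (inv_le_one_of_one_le₀ hk.le)))
        (show 0 < k⁻¹ by positivity) (inv_lt_one_of_one_lt₀ hk)
      have hdn : d ≤ n := by
        have := (pow_lt_pow_iff_right_of_lt_one₀ (show 0 < k⁻¹ by positivity)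
          (inv_lt_one_of_one_lt₀ hk)).mp (hn1.trans hlt)
        omega
      refine ⟨n, hdn, fun _ => ⟨by rwa [inv_pow] at hn2, ?_⟩⟩
      have h1 : (k ^ (n - d))⁻¹ = k * (k ^ d * (k⁻¹) ^ (n + 1)) := by
        rw [show n + 1 = (n - d) + d + 1 by omega, pow_succ, pow_add, inv_pow, inv_pow]
        field_simp
      rw [h1]
      gcongr
    · exact ⟨d, le_rfl, fun h => absurd h hdD⟩
  choose f hf hfD using hex
  have hsum2 : Summable fun d => 2 * (k ^ (f d - d))⁻¹ := by
    refine Summable.mul_left 2 ?_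
    refine Summable.of_norm_bounded_eventually_nat (hsum.mul_left k) ?_
    filter_upwards [eventually_ge_atTop D] with d hd
    rw [Real.norm_of_nonneg (by positivity)]
    exact (hfD d hd).2
  have hBC := measure_setOfPred_frequently_eq_zero (μ := ν)
    (p := fun d x => x ∈ tailBall F 0 ∧ ∃ q p : Polynomial F, q ≠ 0 ∧ q.natDegree = d ∧
      polyToL F q * x - polyToL F p ∈ tailBall F (f d)) (by
    refine ne_top_of_le_ne_top hsum2.tsum_ofReal_ne_top
      (ENNReal.tsum_le_tsum fun d => measure_setOf_exists_approx_le ν (hf d) hν))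
  refine measure_mono_null ?_ hBC
  rintro x ⟨hinf, hx⟩
  by_contra hnot
  have hnot' := not_frequently.mp hnot
  obtain ⟨D', hD'⟩ := eventually_atTop.mp (hnot'.and (eventually_ge_atTop D))
  refine hinf ((finite_solutions_natDegree_lt hψdec hx D').subset ?_)
  rintro ⟨q, p⟩ ⟨hq, h⟩
  refine ⟨hq, ?_, h⟩
  by_contra hlt
  obtain ⟨h1, h2⟩ := hD' q.natDegree (not_lt.mp hlt)
  refine h1 ⟨hx, q, p, hq, rfl, ?_⟩
  rw [← lnorm_lt_zpow_iff, zpow_neg, zpow_natCast]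
  simp only at h
  rw [lnorm_polyToL hq] at h
  exact h.trans_le (hfD _ h2).1

lemma measure_infinite_solutions_eq_one {ψ : ℝ → ℝ} (hψpos : ∀ x > (0 : ℝ), 0 < ψ x)
    (hν : ν (tailBall F 0 : Set (LaurentSeries F)) = 1)
    (hdiv : ¬ Summable fun d : ℕ => (Fintype.card F : ℝ) ^ d * ψ ((Fintype.card F : ℝ) ^ d)) :
    ν ({x | {qp : Polynomial F × Polynomial F | qp.1 ≠ 0 ∧
      lnorm F (polyToL F qp.1 * x - polyToL F qp.2) <
        ψ (lnorm F (polyToL F qp.1))}.Infinite} ∩ tailBall F 0) = 1 := by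
  have hk : (1 : ℝ) < Fintype.card F := one_lt_card
  set k : ℝ := (Fintype.card F : ℝ) with hkdef
  have hk0 : 0 < k := by linarith
  have hex : ∀ d : ℕ, ∃ n, d ≤ n ∧ (k ^ n)⁻¹ ≤ ψ (k ^ d) ∧
      min (k ^ d * ψ (k ^ d)) 1 ≤ k * (k ^ (n - d))⁻¹ := by
    intro d
    have hψ := hψpos (k ^ d) (by positivity)
    obtain ⟨n, hn1, hn2⟩ := exists_nat_pow_near_of_lt_one
      (show 0 < min (ψ (k ^ d)) ((k⁻¹) ^ d) from lt_min hψ (by positivity))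
      ((min_le_right _ _).trans (pow_le_one₀ (by positivity) (inv_le_one_of_one_le₀ hk.le)))
      (show 0 < k⁻¹ by positivity) (inv_lt_one_of_one_lt₀ hk)
    have hdn : d < n + 1 := (pow_lt_pow_iff_right_of_lt_one₀ (show 0 < k⁻¹ by positivity)
      (inv_lt_one_of_one_lt₀ hk)).mp (hn1.trans_le (min_le_right _ _))
    refine ⟨n + 1, hdn.le, ?_, ?_⟩
    · rw [← inv_pow]
      exact (hn1.trans_le (min_le_left _ _)).le
    · have h1 : k * (k ^ (n + 1 - d))⁻¹ = k ^ d * (k⁻¹) ^ n := by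
        rw [show n + 1 - d = (n - d) + 1 by omega, inv_pow]
        conv_rhs => rw [show n = (n - d) + d by omega]
        rw [pow_succ, pow_add]
        field_simp
      have h2 : min (k ^ d * ψ (k ^ d)) 1 = k ^ d * min (ψ (k ^ d)) ((k⁻¹) ^ d) := by
        rw [mul_min_of_nonneg _ _ (by positivity), ← mul_pow, mul_inv_cancel₀ hk0.ne', one_pow]
      rw [h1, h2]
      gcongr
  choose f hf hfψ hfmin using hex
  have hdiv2 : ¬ Summable fun d => (k ^ (f d - d))⁻¹ := by
    intro hsum
    apply hdiv
    have hmin : Summable fun d : ℕ => min (k ^ d * ψ (k ^ d)) 1 :=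
      Summable.of_nonneg_of_le (fun d => le_min
        (mul_pos (by positivity) (hψpos _ (by positivity))).le zero_le_one) hfmin
        (hsum.mul_left k)
    refine Summable.of_norm_bounded_eventually_nat hmin ?_
    filter_upwards [hmin.tendsto_atTop_zero.eventually (gt_mem_nhds zero_lt_one)] with d hd
    have hlt : k ^ d * ψ (k ^ d) < 1 := by
      by_contra h
      rw [min_eq_right (not_lt.mp h)] at hd
      exact lt_irrefl _ hd
    rw [Real.norm_of_nonneg (mul_pos (by positivity) (hψpos _ (by positivity))).le,
      min_eq_left hlt.le]
  have hnull : ν (⋃ N, ⋂ M, avoidSet F f N M) = 0 :=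
    measure_iUnion_null fun N => measure_iInter_avoidSet ν hf hdiv2 (by simp [hν]) N
  apply le_antisymm (hν ▸ measure_mono Set.inter_subset_right)
  rw [← hν, ← measure_sdiff_null hnull]
  refine measure_mono ?_
  rintro x ⟨hx, hxN⟩
  refine ⟨?_, hx⟩
  have hfreq : ∀ N, ∃ d, N ≤ d ∧ x ∈ approxSet F d (f d) := by
    intro N
    by_contra hcon
    push Not at hcon
    refine hxN (Set.mem_iUnion.mpr ⟨N, Set.mem_iInter.mpr fun M => ⟨hx, ?_⟩⟩)
    simp only [Set.mem_iUnion, not_exists]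
    exact fun d hd => hcon d hd.1
  refine Set.Infinite.of_image (fun qp => qp.1.natDegree) ?_
  refine Set.infinite_of_forall_exists_gt fun N => ?_
  obtain ⟨d, hd, q, p, hq, -, rfl, hqp⟩ := hfreq (N + 1)
  refine ⟨q.natDegree, ⟨(q, p), ⟨hq, ?_⟩, rfl⟩, by omega⟩
  rw [← lnorm_lt_zpow_iff, zpow_neg, zpow_natCast] at hqp
  rw [lnorm_polyToL hq]
  exact hqp.trans_le (hfψ _)

end Conclusion

/-- **de Mathan's theorem** (Khintchine's theorem over a field of formal
series).  Let `ψ : ℝ₊ → ℝ₊` be non-increasing.  The set of `x ∈ L` for which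
`‖q x - p‖ < ψ(‖q‖)` has infinitely many solutions `q, p ∈ F[X]`, `q ≠ 0`, is
null or full with respect to the Haar measure `ν` on `L` (normalised so that
the unit ball has measure `1`) according as `∑_{r≥1} ψ(r)` converges or
diverges. -/
theorem de_mathan_khintchine
    {F : Type*} [Field F] [Fintype F]
    (ψ : ℝ → ℝ) (hψpos : ∀ x > (0 : ℝ), 0 < ψ x)
    (hψdec : AntitoneOn ψ (Set.Ioi 0))
    (ν : Measure (LaurentSeries F)) [ν.IsAddHaarMeasure]
    (hν : ν {x : LaurentSeries F | lnorm F x < 1} = 1) :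
    (Summable (fun r : ℕ => ψ ((r : ℝ) + 1)) →
      ν ({x : LaurentSeries F |
        {qp : Polynomial F × Polynomial F | qp.1 ≠ 0 ∧
          lnorm F (polyToL F qp.1 * x - polyToL F qp.2) <
            ψ (lnorm F (polyToL F qp.1))}.Infinite} ∩
        {x : LaurentSeries F | lnorm F x < 1}) = 0) ∧
    (¬ Summable (fun r : ℕ => ψ ((r : ℝ) + 1)) →
      ν ({x : LaurentSeries F |
        {qp : Polynomial F × Polynomial F | qp.1 ≠ 0 ∧
          lnorm F (polyToL F qp.1 * x - polyToL F qp.2) <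
            ψ (lnorm F (polyToL F qp.1))}.Infinite} ∩
        {x : LaurentSeries F | lnorm F x < 1}) = 1) := by
  have hball : {x : LaurentSeries F | lnorm F x < 1} = tailBall F 0 := by
    ext x
    have h := lnorm_lt_zpow_iff (F := F) (n := 0) (x := x)
    rwa [neg_zero, zpow_zero] at h
  rw [hball] at hν ⊢
  rw [← summable_condensed_card (F := F) hψpos hψdec]
  exact ⟨measure_infinite_solutions_eq_zero ν hψpos hψdec hν,
    measure_infinite_solutions_eq_one ν hψpos hν⟩
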